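/- For any standard tableau T of shape λ with n nodes in the type C_ℓ^{(1)} setting, deg(T) + codeg(T) = def(Λ_0, β), where β = Σ_{k=1}^n α_{res_k(T)} and def(Λ_0, β) = (β | Λ_0) - (1/2)(β | β). -/

import Mathlib

/-- The C_ℓ^{(1)} residue of a node in row p, column q (0-based):
res = min(r, 2ℓ − r) where r = (q − p) mod 2ℓ. -/
def resN (ℓ p q : ℕ) : ℕ :=
  let r := (((q : ℤ) - (p : ℤ)) % (2 * ℓ)).toNat
  min r (2 * ℓ - r)

/-- d_i = 2 for i ∈ {0, ℓ} and d_i = 1 otherwise. -/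
def dC (ℓ i : ℕ) : ℕ := if i = 0 ∨ i = ℓ then 2 else 1

/-- A Young diagram is given by its row lengths `lam : ℕ → ℕ`.
Row p has an addable node (at column `lam p`) iff p = 0 or `lam (p-1) > lam p`. -/
def AddableRow (lam : ℕ → ℕ) (p : ℕ) : Prop := p = 0 ∨ lam p < lam (p - 1)

/-- Row p has a removable node (at column `lam p − 1`) iff `lam (p+1) < lam p`. -/
def RemovableRow (lam : ℕ → ℕ) (p : ℕ) : Prop := lam (p + 1) < lam p ∧ 0 < lam p

/-- d_b(λ) for the (addable or removable) i-node b in row p: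
d_i · (# addable i-nodes strictly below b − # removable i-nodes strictly below b). -/
noncomputable def dLow (ℓ : ℕ) (lam : ℕ → ℕ) (i p : ℕ) : ℤ :=
  (dC ℓ i : ℤ) *
    (({r | p < r ∧ AddableRow lam r ∧ resN ℓ r (lam r) = i}.ncard : ℤ) -
     ({r | p < r ∧ RemovableRow lam r ∧ resN ℓ r (lam r - 1) = i}.ncard : ℤ))

/-- d^b(λ) for the (addable or removable) i-node b in row p:
d_i · (# addable i-nodes strictly above b − # removable i-nodes strictly above b). -/
noncomputable def dUp (ℓ : ℕ) (lam : ℕ → ℕ) (i p : ℕ) : ℤ :=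
  (dC ℓ i : ℤ) *
    (({r | r < p ∧ AddableRow lam r ∧ resN ℓ r (lam r) = i}.ncard : ℤ) -
     ({r | r < p ∧ RemovableRow lam r ∧ resN ℓ r (lam r - 1) = i}.ncard : ℤ))

/-- The C_ℓ^{(1)} affine Cartan matrix on {0,…,ℓ}. -/
def cartanC1 (ℓ i j : ℕ) : ℤ :=
  if i = j then 2
  else if i = 1 ∧ j = 0 then -2
  else if i = ℓ - 1 ∧ j = ℓ then -2
  else if i + 1 = j ∨ j + 1 = i then -1
  else 0

/-- The `C_ℓ^{(1)}` residue as a function of the content `c` of a node. -/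
def contentRes (ℓ : ℕ) (c : ℤ) : ℕ :=
  min (c % (2 * ℓ)).toNat (2 * ℓ - (c % (2 * ℓ)).toNat)

lemma resN_eq_contentRes (ℓ p q : ℕ) : resN ℓ p q = contentRes ℓ ((q : ℤ) - p) := rfl

lemma contentRes_le (ℓ : ℕ) (c : ℤ) : contentRes ℓ c ≤ ℓ := by
  unfold contentRes; omega

lemma emod_add_one_cases {m : ℤ} (hm : 0 < m) (c : ℤ) :
    (c % m + 1 < m ∧ (c + 1) % m = c % m + 1) ∨ (c % m + 1 = m ∧ (c + 1) % m = 0) := by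
  have hlt := Int.emod_lt_of_pos c hm
  have hnonneg := Int.emod_nonneg c hm.ne'
  rw [← Int.emod_add_emod]
  rcases (show c % m + 1 < m ∨ c % m + 1 = m by omega) with h | h
  · exact Or.inl ⟨h, Int.emod_eq_of_lt (by omega) h⟩
  · exact Or.inr ⟨h, by rw [h, Int.emod_self]⟩

lemma contentRes_add_one_ne {ℓ : ℕ} (hℓ : 2 ≤ ℓ) (c : ℤ) :
    contentRes ℓ (c + 1) ≠ contentRes ℓ c := by
  have hm : (0 : ℤ) < 2 * ℓ := by omega
  have hlt := Int.emod_lt_of_pos c hm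
  have hnonneg := Int.emod_nonneg c hm.ne'
  unfold contentRes
  rcases emod_add_one_cases hm c with ⟨h, e⟩ | ⟨h, e⟩ <;> rw [e] <;>
    generalize c % (2 * (ℓ : ℤ)) = r at * <;> omega

/-- The indicator function of the contents of residue `i`. -/
def resIndicator (ℓ i : ℕ) (c : ℤ) : ℤ := if contentRes ℓ c = i then 1 else 0

/-- The second difference of the residue indicator is a row of the Cartan matrix. -/
lemma resIndicator_second_difference {ℓ i : ℕ} (hℓ : 2 ≤ ℓ) (hi : i ≤ ℓ) (c : ℤ) :
    resIndicator ℓ i (c + 1) + resIndicator ℓ i (c - 1) - 2 * resIndicator ℓ i c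
      = -cartanC1 ℓ i (contentRes ℓ c) := by
  have hm : (0 : ℤ) < 2 * ℓ := by omega
  have hlt := Int.emod_lt_of_pos c hm
  have hnonneg := Int.emod_nonneg c hm.ne'
  have hlt' := Int.emod_lt_of_pos (c - 1) hm
  have hnonneg' := Int.emod_nonneg (c - 1) hm.ne'
  have hnext := emod_add_one_cases hm c
  have hprev := emod_add_one_cases hm (c - 1)
  rw [sub_add_cancel] at hprev
  have key : (contentRes ℓ c = 0 ∧ contentRes ℓ (c + 1) = 1 ∧ contentRes ℓ (c - 1) = 1) ∨
      (contentRes ℓ c = ℓ ∧ contentRes ℓ (c + 1) = ℓ - 1 ∧ contentRes ℓ (c - 1) = ℓ - 1) ∨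
      (0 < contentRes ℓ c ∧ contentRes ℓ c < ℓ ∧
        ((contentRes ℓ (c + 1) = contentRes ℓ c + 1 ∧ contentRes ℓ (c - 1) = contentRes ℓ c - 1) ∨
        (contentRes ℓ (c + 1) = contentRes ℓ c - 1 ∧
          contentRes ℓ (c - 1) = contentRes ℓ c + 1))) := by
    unfold contentRes
    generalize (c + 1) % (2 * (ℓ : ℤ)) = s at *
    generalize (c - 1) % (2 * (ℓ : ℤ)) = t at *
    generalize c % (2 * (ℓ : ℤ)) = r at *
    lift r to ℕ using hnonneg
    lift t to ℕ using hnonneg'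
    rcases hnext with ⟨h, rfl⟩ | ⟨h, rfl⟩ <;> rcases hprev with ⟨h', e⟩ | ⟨h', e⟩
    · rcases lt_trichotomy r ℓ with hr | hr | hr
      · exact Or.inr (Or.inr ⟨by omega, by omega, Or.inl ⟨by omega, by omega⟩⟩)
      · exact Or.inr (Or.inl ⟨by omega, by omega, by omega⟩)
      · exact Or.inr (Or.inr ⟨by omega, by omega, Or.inr ⟨by omega, by omega⟩⟩)
    · exact Or.inl ⟨by omega, by omega, by omega⟩
    · exact Or.inr (Or.inr ⟨by omega, by omega, Or.inr ⟨by omega, by omega⟩⟩)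
    · omega
  unfold resIndicator cartanC1
  generalize contentRes ℓ (c + 1) = s at *
  generalize contentRes ℓ (c - 1) = t at *
  generalize contentRes ℓ c = r at *
  clear hnext hprev hlt hlt' hnonneg hnonneg'
  rcases key with ⟨rfl, rfl, rfl⟩ | ⟨rfl, rfl, rfl⟩ | ⟨hr, hr', ⟨rfl, rfl⟩ | ⟨rfl, rfl⟩⟩ <;>
    split_ifs <;> first | omega | simp_all

open Classical in
/-- The number of addable minus the number of removable `i`-nodes in row `r`. -/
noncomputable def rowSign (ℓ i : ℕ) (lam : ℕ → ℕ) (r : ℕ) : ℤ :=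
  (if AddableRow lam r ∧ resN ℓ r (lam r) = i then 1 else 0) -
    (if RemovableRow lam r ∧ resN ℓ r (lam r - 1) = i then 1 else 0)

lemma ncard_eq_sum_range {N : ℕ} {P : ℕ → Prop} [DecidablePred P] (hP : ∀ r, P r → r < N) :
    ({r | P r}.ncard : ℤ) = ∑ r ∈ Finset.range N, if P r then 1 else 0 := by
  have : {r | P r} = ((Finset.range N).filter P : Set ℕ) := by
    ext r; simpa using hP r
  rw [this, Set.ncard_coe_finset, Finset.sum_boole]

lemma AddableRow.lt_of_support {lam : ℕ → ℕ} {N r : ℕ} (h : AddableRow lam r)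
    (hN : ∀ r, N ≤ r → lam r = 0) : r < N + 1 := by
  by_contra hr
  rcases h with h | h
  · omega
  · rw [hN (r - 1) (by omega)] at h; omega

lemma RemovableRow.lt_of_support {lam : ℕ → ℕ} {N r : ℕ} (h : RemovableRow lam r)
    (hN : ∀ r, N ≤ r → lam r = 0) : r < N := by
  by_contra hr
  have := h.2
  rw [hN r (by omega)] at this
  omega

lemma dLow_eq_sum {ℓ i p N : ℕ} {lam : ℕ → ℕ} (hN : ∀ r, N ≤ r → lam r = 0) :
    dLow ℓ lam i p = dC ℓ i * ∑ r ∈ Finset.range (N + 1), if p < r then rowSign ℓ i lam r else 0 := by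
  classical
  unfold dLow
  rw [ncard_eq_sum_range (N := N + 1) fun r h => h.2.1.lt_of_support hN,
    ncard_eq_sum_range (N := N + 1) fun r h => (h.2.1.lt_of_support hN).trans (Nat.lt_succ_self N),
    ← Finset.sum_sub_distrib]
  congr 1
  refine Finset.sum_congr rfl fun r _ => ?_
  by_cases h : p < r <;> simp [h, rowSign]

lemma dUp_eq_sum {ℓ i p N : ℕ} {lam : ℕ → ℕ} (hN : ∀ r, N ≤ r → lam r = 0) :
    dUp ℓ lam i p = dC ℓ i * ∑ r ∈ Finset.range (N + 1), if r < p then rowSign ℓ i lam r else 0 := by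
  classical
  unfold dUp
  rw [ncard_eq_sum_range (N := N + 1) fun r h => h.2.1.lt_of_support hN,
    ncard_eq_sum_range (N := N + 1) fun r h => (h.2.1.lt_of_support hN).trans (Nat.lt_succ_self N),
    ← Finset.sum_sub_distrib]
  congr 1
  refine Finset.sum_congr rfl fun r _ => ?_
  by_cases h : r < p <;> simp [h, rowSign]

/-- Addable minus removable `i`-nodes, as a signed sum over the boundary of the diagram. -/
lemma sum_rowSign {ℓ i N : ℕ} {lam : ℕ → ℕ} (hanti : Antitone lam)
    (hN : ∀ r, N ≤ r → lam r = 0) :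
    ∑ r ∈ Finset.range (N + 1), rowSign ℓ i lam r = resIndicator ℓ i (lam 0) +
      ∑ r ∈ Finset.range N,
        (resIndicator ℓ i (lam (r + 1) - (r + 1)) - resIndicator ℓ i (lam r - (r + 1))) := by
  classical
  unfold rowSign
  rw [Finset.sum_sub_distrib, Finset.sum_range_succ', Finset.sum_range_succ (n := N),
    if_neg (c := RemovableRow lam N ∧ _) fun h => (h.1.lt_of_support hN).false, add_zero,
    add_sub_right_comm, ← Finset.sum_sub_distrib, add_comm]
  congr 1
  · simp [AddableRow, resIndicator, resN_eq_contentRes]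
  · refine Finset.sum_congr rfl fun r _ => ?_
    rcases (hanti (Nat.le_succ r)).lt_or_eq with h | h
    · have hpos : 0 < lam r := by omega
      have hadd : AddableRow lam (r + 1) := Or.inr h
      have hrem : RemovableRow lam r := ⟨h, hpos⟩
      simp only [hadd, hrem, true_and, resIndicator, resN_eq_contentRes]
      push_cast [Nat.cast_sub (show 1 ≤ lam r from hpos)]
      rw [show (lam r : ℤ) - 1 - r = lam r - (r + 1) by ring]
    · simp only [Nat.succ_eq_add_one] at h
      have hadd : ¬AddableRow lam (r + 1) := by
        simp [AddableRow]; omega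
      have hrem : ¬RemovableRow lam r := by
        simp [RemovableRow]; omega
      simp [hadd, hrem, h]

lemma sum_rowSign_update {ℓ i N p : ℕ} {lam mu : ℕ → ℕ} (hℓ : 2 ≤ ℓ) (hi : i ≤ ℓ)
    (hlam : Antitone lam) (hmu : Antitone mu) (hN : ∀ r, N ≤ r → lam r = 0)
    (hN' : ∀ r, N ≤ r → mu r = 0) (h : mu = Function.update lam p (lam p + 1)) :
    ∑ r ∈ Finset.range (N + 1), rowSign ℓ i mu r =
      ∑ r ∈ Finset.range (N + 1), rowSign ℓ i lam r - cartanC1 ℓ i (resN ℓ p (lam p)) := by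
  have hp : p < N := by
    by_contra hp
    have := hN' p (by omega)
    simp [h] at this
  have hdiff := resIndicator_second_difference hℓ hi ((lam p : ℤ) - p)
  have telescope : ∀ nu : ℕ → ℕ, (∀ r, N ≤ r → nu r = 0) →
      resIndicator ℓ i (nu 0) + ∑ r ∈ Finset.range N,
        (resIndicator ℓ i (nu (r + 1) - (r + 1)) - resIndicator ℓ i (nu r - (r + 1))) =
      resIndicator ℓ i (-N) + ∑ r ∈ Finset.range N,
        (resIndicator ℓ i (nu r - r) - resIndicator ℓ i (nu r - (r + 1))) := by
    intro nu hnu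
    have h1 := Finset.sum_range_succ (fun r : ℕ => resIndicator ℓ i (nu r - r)) N
    have h2 := Finset.sum_range_succ' (fun r : ℕ => resIndicator ℓ i (nu r - r)) N
    simp only [hnu N le_rfl, Nat.cast_zero, zero_sub, sub_zero, Nat.cast_add, Nat.cast_one]
      at h1 h2
    simp only [Finset.sum_sub_distrib]
    linarith
  rw [sum_rowSign hlam hN, sum_rowSign hmu hN', telescope lam hN, telescope mu hN',
    ← Finset.add_sum_erase _ _ (Finset.mem_range.2 hp),
    ← Finset.add_sum_erase (Finset.range N) (fun r : ℕ =>
      resIndicator ℓ i (lam r - r) - resIndicator ℓ i (lam r - (r + 1))) (Finset.mem_range.2 hp)]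
  have hrest : ∑ r ∈ (Finset.range N).erase p,
      (resIndicator ℓ i (mu r - r) - resIndicator ℓ i (mu r - (r + 1))) =
      ∑ r ∈ (Finset.range N).erase p,
      (resIndicator ℓ i (lam r - r) - resIndicator ℓ i (lam r - (r + 1))) := by
    refine Finset.sum_congr rfl fun r hr => ?_
    rw [h, Function.update_of_ne (Finset.ne_of_mem_erase hr)]
  have hmup : (mu p : ℤ) = lam p + 1 := by simp [h]
  rw [hrest, hmup, resN_eq_contentRes]
  rw [show (lam p : ℤ) + 1 - p = lam p - p + 1 by ring,
    show (lam p : ℤ) + 1 - (p + 1) = lam p - p by ring,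
    show (lam p : ℤ) - (p + 1) = lam p - p - 1 by ring]
  linarith

/-- Adding a node `b` in row `p` contributes all addable minus removable nodes of its residue,
except `b` itself. -/
lemma dLow_add_dUp {ℓ N p : ℕ} {lam mu : ℕ → ℕ} (hℓ : 2 ≤ ℓ) (hlam : Antitone lam)
    (hN : ∀ r, N ≤ r → lam r = 0) (hN' : ∀ r, N ≤ r → mu r = 0) (hadd : AddableRow lam p)
    (h : mu = Function.update lam p (lam p + 1)) :
    dLow ℓ mu (resN ℓ p (lam p)) p + dUp ℓ lam (resN ℓ p (lam p)) p =
      dC ℓ (resN ℓ p (lam p)) *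
        (∑ r ∈ Finset.range (N + 1), rowSign ℓ (resN ℓ p (lam p)) lam r - 1) := by
  classical
  have hp : p < N + 1 := hadd.lt_of_support hN
  rw [dLow_eq_sum hN', dUp_eq_sum hN, ← mul_add, ← Finset.sum_add_distrib]
  congr 1
  rw [← Finset.add_sum_erase _ _ (Finset.mem_range.2 hp),
    ← Finset.add_sum_erase _ (rowSign ℓ _ lam) (Finset.mem_range.2 hp)]
  have hself : rowSign ℓ (resN ℓ p (lam p)) lam p = 1 := by
    have hrem : ¬(RemovableRow lam p ∧ resN ℓ p (lam p - 1) = resN ℓ p (lam p)) := by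
      rintro ⟨⟨-, hpos⟩, hres⟩
      refine contentRes_add_one_ne hℓ ((lam p - 1 : ℕ) - p : ℤ) ?_
      rw [resN_eq_contentRes, resN_eq_contentRes] at hres
      rw [hres]
      congr 1
      omega
    simp only [rowSign, hadd, hrem]
    simp
  rw [hself]
  simp only [lt_irrefl, if_false, add_zero, zero_add, add_sub_cancel_left]
  refine Finset.sum_congr rfl fun r hr => ?_
  have hrp := Finset.ne_of_mem_erase hr
  rcases lt_or_gt_of_ne hrp with hlt | hgt
  · simp [hlt, hlt.le]
  · rw [if_pos hgt, if_neg (by omega), add_zero]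
    have hmu : ∀ s, s ≠ p → mu s = lam s := fun s hs => by rw [h, Function.update_of_ne hs]
    have hmup : mu p = lam p + 1 := by simp [h]
    have hA : (AddableRow mu r ∧ resN ℓ r (lam r) = resN ℓ p (lam p)) ↔
        (AddableRow lam r ∧ resN ℓ r (lam r) = resN ℓ p (lam p)) := by
      refine and_congr_left fun hres => ?_
      by_cases hr1 : r - 1 = p
      · obtain rfl : r = p + 1 := by omega
        have hle := hlam (Nat.le_succ p)
        have hne : lam (p + 1) ≠ lam p := by
          intro he
          rw [resN_eq_contentRes, resN_eq_contentRes, he] at hres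
          refine contentRes_add_one_ne hℓ ((lam p : ℤ) - (p + 1 : ℕ)) ?_
          rw [hres]
          congr 1
          push_cast
          ring
        simp only [Nat.succ_eq_add_one] at hle
        simp only [AddableRow, hmu _ hrp, Nat.add_sub_cancel, hmup]
        omega
      · simp only [AddableRow, hmu _ hrp, hmu _ hr1]
    have hR : RemovableRow mu r ↔ RemovableRow lam r := by
      simp only [RemovableRow, hmu _ hrp, hmu (r + 1) (by omega)]
    simp only [rowSign, hmu _ hrp, hA, hR]

lemma antitone_update {lam : ℕ → ℕ} {p : ℕ} (hlam : Antitone lam) (hadd : AddableRow lam p) :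
    Antitone (Function.update lam p (lam p + 1)) := by
  refine antitone_nat_of_succ_le fun r => ?_
  have hr := hlam (Nat.le_succ r)
  simp only [Nat.succ_eq_add_one] at hr
  by_cases h1 : r = p
  · subst h1
    simp
    omega
  · by_cases h2 : r + 1 = p
    · subst h2
      rw [Function.update_self, Function.update_of_ne h1]
      rcases hadd with h | h
      · omega
      · simpa using h
    · rwa [Function.update_of_ne h1, Function.update_of_ne h2]

lemma dC_mul_cartanC1_symm {ℓ : ℕ} (hℓ : 2 ≤ ℓ) {i j : ℕ} (hi : i ≤ ℓ) (hj : j ≤ ℓ) :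
    (dC ℓ i : ℤ) * cartanC1 ℓ i j = dC ℓ j * cartanC1 ℓ j i := by
  unfold dC cartanC1
  split_ifs <;> omega

lemma sum_card_fiber_mul {n ℓ : ℕ} (g : ℕ → ℕ) (hg : ∀ k, g k ≤ ℓ) (f : ℕ → ℚ) :
    ∑ i ∈ Finset.range (ℓ + 1), (((Finset.range n).filter (fun k => g k = i)).card : ℚ) * f i =
      ∑ k ∈ Finset.range n, f (g k) := by
  rw [← Finset.sum_fiberwise_of_maps_to (s := Finset.range n) (t := Finset.range (ℓ + 1)) (g := g)
    fun k _ => Finset.mem_range.2 (Nat.lt_succ_of_le (hg k))]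
  refine Finset.sum_congr rfl fun i _ => ?_
  rw [← nsmul_eq_mul, ← Finset.sum_const]
  refine Finset.sum_congr rfl fun k hk => ?_
  rw [(Finset.mem_filter.1 hk).2]

lemma sum_lower_triangle (n : ℕ) (b : ℕ → ℕ → ℚ) (hb : ∀ s t, b s t = b t s) :
    ∑ s ∈ Finset.range n, ∑ t ∈ Finset.range n, b s t =
      ∑ s ∈ Finset.range n, (2 * ∑ t ∈ Finset.range s, b s t + b s s) := by
  induction n with
  | zero => simp
  | succ n ih =>
    rw [Finset.sum_range_succ (fun s => 2 * _ + _), ← ih]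
    simp only [Finset.sum_range_succ _ n, Finset.sum_add_distrib]
    rw [Finset.sum_congr rfl fun s _ => hb s n]
    ring

/-- Along a standard tableau, the signed count of `i`-nodes is `δ_{i,0} - ∑ a_{ij}` over the
residues `j` of the entries added so far. -/
lemma tableau_invariants {ℓ n : ℕ} (hℓ : 2 ≤ ℓ) {T : ℕ → ℕ → ℕ} {row : ℕ → ℕ}
    (h0 : T 0 = fun _ => 0)
    (hstep : ∀ k < n, AddableRow (T k) (row k) ∧
      T (k + 1) = Function.update (T k) (row k) (T k (row k) + 1)) {k : ℕ} (hk : k ≤ n) :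
    Antitone (T k) ∧ (∀ r, k ≤ r → T k r = 0) ∧
      ∀ i ≤ ℓ, ∑ r ∈ Finset.range (n + 1), rowSign ℓ i (T k) r =
        (if i = 0 then 1 else 0) -
          ∑ t ∈ Finset.range k, cartanC1 ℓ i (resN ℓ (row t) (T t (row t))) := by
  induction k with
  | zero =>
    have hanti : Antitone (T 0) := by rw [h0]; exact antitone_const
    refine ⟨hanti, by simp [h0], fun i _ => ?_⟩
    rw [sum_rowSign hanti (by simp [h0])]
    simp [h0, resIndicator, contentRes, eq_comm]
  | succ k ih =>
    obtain ⟨hanti, hsupp, hsum⟩ := ih (by omega)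
    obtain ⟨hadd, hupd⟩ := hstep k (by omega)
    have hrow := hadd.lt_of_support hsupp
    have hanti' : Antitone (T (k + 1)) := hupd ▸ antitone_update hanti hadd
    have hsupp' : ∀ r, k + 1 ≤ r → T (k + 1) r = 0 := fun r hr => by
      rw [hupd, Function.update_of_ne (by omega)]
      exact hsupp r (by omega)
    refine ⟨hanti', hsupp', fun i hi => ?_⟩
    rw [sum_rowSign_update hℓ hi hanti hanti' (fun r hr => hsupp r (by omega))
      (fun r hr => hsupp' r (by omega)) hupd, hsum i hi, Finset.sum_range_succ]
    ring

/-- for a standard tableau (encoded as a chain of Young diagrams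
`T 0 = ∅ ⊂ T 1 ⊂ ⋯ ⊂ T n = λ`, where step k adds an addable node in row `row k`),
deg(T) + codeg(T) = def(Λ₀, β) = (β|Λ₀) − (1/2)(β|β), where
β = Σ_k α_{res_k(T)}, (α_i|Λ₀) = d_i δ_{i,0}, and (α_i|α_j) = d_i a_{ij}. -/
theorem stmt4 (ℓ n : ℕ) (hℓ : 2 ≤ ℓ) (T : ℕ → ℕ → ℕ) (row : ℕ → ℕ)
    (h0 : T 0 = fun _ => 0)
    (hstep : ∀ k < n, AddableRow (T k) (row k) ∧
      T (k + 1) = Function.update (T k) (row k) (T k (row k) + 1)) :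
    (((∑ k ∈ Finset.range n,
          dLow ℓ (T (k + 1)) (resN ℓ (row k) (T k (row k))) (row k)) +
        (∑ k ∈ Finset.range n,
          dUp ℓ (T k) (resN ℓ (row k) (T k (row k))) (row k)) : ℤ) : ℚ)
    = (dC ℓ 0 : ℚ) *
        (((Finset.range n).filter (fun k => resN ℓ (row k) (T k (row k)) = 0)).card : ℚ)
      - (1 / 2) * ∑ i ∈ Finset.range (ℓ + 1), ∑ j ∈ Finset.range (ℓ + 1),
          (((Finset.range n).filter (fun k => resN ℓ (row k) (T k (row k)) = i)).card : ℚ)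
            * (dC ℓ i : ℚ) * (cartanC1 ℓ i j : ℚ)
            * (((Finset.range n).filter (fun k => resN ℓ (row k) (T k (row k)) = j)).card : ℚ) := by
  set g : ℕ → ℕ := fun k => resN ℓ (row k) (T k (row k)) with hg
  have hgle : ∀ k, g k ≤ ℓ := fun k => contentRes_le _ _
  have hdouble : ∑ i ∈ Finset.range (ℓ + 1), ∑ j ∈ Finset.range (ℓ + 1),
      (((Finset.range n).filter (fun k => g k = i)).card : ℚ) * (dC ℓ i : ℚ) *
        (cartanC1 ℓ i j : ℚ) * (((Finset.range n).filter (fun k => g k = j)).card : ℚ) =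
      ∑ s ∈ Finset.range n, ∑ t ∈ Finset.range n,
        (dC ℓ (g s) : ℚ) * (cartanC1 ℓ (g s) (g t) : ℚ) := by
    rw [← sum_card_fiber_mul g hgle
      fun i => ∑ t ∈ Finset.range n, (dC ℓ i : ℚ) * (cartanC1 ℓ i (g t) : ℚ)]
    refine Finset.sum_congr rfl fun i _ => ?_
    rw [← sum_card_fiber_mul g hgle fun j => (dC ℓ i : ℚ) * (cartanC1 ℓ i j : ℚ), Finset.mul_sum]
    exact Finset.sum_congr rfl fun j _ => by ring
  have hsymm : ∀ s t, (dC ℓ (g s) : ℚ) * (cartanC1 ℓ (g s) (g t) : ℚ) =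
      (dC ℓ (g t) : ℚ) * (cartanC1 ℓ (g t) (g s) : ℚ) := fun s t => by
    exact_mod_cast dC_mul_cartanC1_symm hℓ (hgle s) (hgle t)
  have hlin : (dC ℓ 0 : ℚ) * (((Finset.range n).filter (fun k => g k = 0)).card : ℚ) =
      ∑ k ∈ Finset.range n, (dC ℓ (g k) : ℚ) * (if g k = 0 then 1 else 0) := by
    rw [← Finset.sum_boole, Finset.mul_sum]
    refine Finset.sum_congr rfl fun k _ => ?_
    by_cases h : g k = 0 <;> simp [h]
  rw [hdouble, sum_lower_triangle n _ hsymm, hlin, Finset.mul_sum, ← Finset.sum_sub_distrib,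
    ← Finset.sum_add_distrib, Int.cast_sum]
  refine Finset.sum_congr rfl fun k hk => ?_
  have hk := Finset.mem_range.1 hk
  obtain ⟨hanti, hsupp, hsum⟩ := tableau_invariants hℓ h0 hstep hk.le
  obtain ⟨-, hsupp', -⟩ := tableau_invariants hℓ h0 hstep (Nat.succ_le_of_lt hk)
  obtain ⟨hadd, hupd⟩ := hstep k hk
  rw [dLow_add_dUp (N := n) hℓ hanti (fun r hr => hsupp r (by omega)) (fun r hr => hsupp' r (by omega))
    hadd hupd, hsum _ (hgle k)]
  have hdiag : cartanC1 ℓ (g k) (g k) = 2 := by simp [cartanC1]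
  rw [hdiag, ← Finset.mul_sum]
  push_cast
  ring
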